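/- Let Ω*^{(2)} be the partition of [0,1]^2 into the two congruent triangles cut off by the anti-diagonal {x + y = 1}, and let P be the stratified sample consisting of one uniform random point in each triangle. Then E L2(P)^2 = 1/20, and this is the minimum of E L2(P_Ω)^2 over all equivolume partitions Ω of [0,1]^2 into two closed convex sets. -/

import Mathlib

open MeasureTheory Set
open scoped ENNReal

/-- The half-open box `[0,x) = ∏_j [0, x_j)`. -/
def box (d : ℕ) (x : Fin d → ℝ) : Set (Fin d → ℝ) :=
  Set.univ.pi fun j => Set.Ico 0 (x j)

/-- The squared `L2`-discrepancy of the point set `P` in `[0,1]^d`. -/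
noncomputable def disc2 (d N : ℕ) (P : Fin N → Fin d → ℝ) : ℝ :=
  ∫ x in Set.Icc (0 : Fin d → ℝ) 1,
    ((Set.ncard {i | P i ∈ box d x} : ℝ) / N - (volume (box d x)).toReal) ^ 2

/-- The uniform probability measure on a set `Ω` (normalized Lebesgue measure). -/
noncomputable def unif {d : ℕ} (Ω : Set (Fin d → ℝ)) : Measure (Fin d → ℝ) :=
  (volume Ω)⁻¹ • volume.restrict Ω

/-- The mean squared `L2`-discrepancy of the stratified sample with one uniform point
in each of the two sets `Ω 0`, `Ω 1`. -/
noncomputable def meanDisc2 (Ω : Fin 2 → Set (Fin 2 → ℝ)) : ℝ :=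
  ∫ P, disc2 2 2 P ∂(Measure.pi fun i => unif (Ω i))

/-- The lower triangle cut off by the anti-diagonal `x + y = 1`. -/
def lowerTri : Set (Fin 2 → ℝ) :=
  {x ∈ Set.Icc (0 : Fin 2 → ℝ) 1 | x 0 + x 1 ≤ 1}

/-- The upper triangle cut off by the anti-diagonal `x + y = 1`. -/
def upperTri : Set (Fin 2 → ℝ) :=
  {x ∈ Set.Icc (0 : Fin 2 → ℝ) 1 | 1 ≤ x 0 + x 1}

/-- The line of slope `m` through the center of the unit square. -/
noncomputable def midline (m u : ℝ) : ℝ := 1 / 2 + m * (u - 1 / 2)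

@[fun_prop]
lemma continuous_midline (m : ℝ) : Continuous (midline m) := by
  unfold midline; fun_prop

lemma midline_mem_Icc {m u : ℝ} (hm : m ∈ Icc (-1 : ℝ) 1) (hu : u ∈ Icc (0 : ℝ) 1) :
    midline m u ∈ Icc (0 : ℝ) 1 := by
  obtain ⟨h1, h2⟩ := hm
  obtain ⟨h3, h4⟩ := hu
  unfold midline
  constructor <;> nlinarith [mul_nonneg (sub_nonneg.2 h2) h3, mul_nonneg (sub_nonneg.2 h1) h3,
    mul_nonneg (sub_nonneg.2 h2) (sub_nonneg.2 h4), mul_nonneg (sub_nonneg.2 h1) (sub_nonneg.2 h4)]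

lemma integral_quintic (a c₀ c₁ c₂ c₃ c₄ c₅ : ℝ) (x : ℝ) :
    ∫ u in a..x, (c₀ + c₁ * u + c₂ * u ^ 2 + c₃ * u ^ 3 + c₄ * u ^ 4 + c₅ * u ^ 5) =
      (c₀ * x + c₁ * x ^ 2 / 2 + c₂ * x ^ 3 / 3 + c₃ * x ^ 4 / 4 + c₄ * x ^ 5 / 5
        + c₅ * x ^ 6 / 6) -
      (c₀ * a + c₁ * a ^ 2 / 2 + c₂ * a ^ 3 / 3 + c₃ * a ^ 4 / 4 + c₄ * a ^ 5 / 5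
        + c₅ * a ^ 6 / 6) := by
  refine intervalIntegral.integral_eq_sub_of_hasDerivAt
    (f := fun u => c₀ * u + c₁ * u ^ 2 / 2 + c₂ * u ^ 3 / 3 + c₃ * u ^ 4 / 4 + c₄ * u ^ 5 / 5
        + c₅ * u ^ 6 / 6) (fun u _ => ?_) (Continuous.intervalIntegrable (by fun_prop) _ _)
  have := (((((((hasDerivAt_id u).const_mul c₀).add
    (((hasDerivAt_pow 2 u).const_mul c₁).div_const 2)).add
    (((hasDerivAt_pow 3 u).const_mul c₂).div_const 3)).add
    (((hasDerivAt_pow 4 u).const_mul c₃).div_const 4)).add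
    (((hasDerivAt_pow 5 u).const_mul c₄).div_const 5)).add
    (((hasDerivAt_pow 6 u).const_mul c₅).div_const 6))
  refine this.congr_deriv ?_
  norm_num
  ring

lemma integral_tent_mul_tent {a b : ℝ} (ha : 0 ≤ a) (hab : a ≤ b) (hb : b ≤ 1) :
    ∫ y in (0 : ℝ)..1, (a - |y - a|) * (b - |y - b|) =
      -a ^ 3 / 3 - 2 * a * b ^ 2 + b ^ 3 / 3 + 4 * a * b - a - b + 1 / 3 := by
  have hc : Continuous fun y : ℝ => (a - |y - a|) * (b - |y - b|) := by fun_prop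
  rw [← intervalIntegral.integral_add_adjacent_intervals (hc.intervalIntegrable 0 a)
      (hc.intervalIntegrable a 1),
    ← intervalIntegral.integral_add_adjacent_intervals (hc.intervalIntegrable a b)
      (hc.intervalIntegrable b 1)]
  have h1 : ∫ y in (0 : ℝ)..a, (a - |y - a|) * (b - |y - b|) =
      ∫ y in (0 : ℝ)..a, (0 + 0 * y + 1 * y ^ 2 + 0 * y ^ 3 + 0 * y ^ 4 + 0 * y ^ 5) := by
    refine intervalIntegral.integral_congr fun y hy => ?_
    rw [uIcc_of_le ha] at hy
    rw [abs_of_nonpos (by linarith [hy.2]), abs_of_nonpos (by linarith [hy.2])]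
    ring
  have h2 : ∫ y in a..b, (a - |y - a|) * (b - |y - b|) =
      ∫ y in a..b, (0 + (2 * a) * y + (-1) * y ^ 2 + 0 * y ^ 3 + 0 * y ^ 4 + 0 * y ^ 5) := by
    refine intervalIntegral.integral_congr fun y hy => ?_
    rw [uIcc_of_le hab] at hy
    rw [abs_of_nonneg (by linarith [hy.1]), abs_of_nonpos (by linarith [hy.2])]
    ring
  have h3 : ∫ y in b..1, (a - |y - a|) * (b - |y - b|) =
      ∫ y in b..1, (4 * a * b + (-2 * (a + b)) * y + 1 * y ^ 2 + 0 * y ^ 3 + 0 * y ^ 4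
        + 0 * y ^ 5) := by
    refine intervalIntegral.integral_congr fun y hy => ?_
    rw [uIcc_of_le hb] at hy
    rw [abs_of_nonneg (by linarith [hy.1]), abs_of_nonneg (by linarith [hy.1])]
    ring
  rw [h1, h2, h3, integral_quintic, integral_quintic, integral_quintic]
  ring

lemma sq_integral_eq {φ : ℝ → ℝ} (hφ : Continuous φ) (x : ℝ) :
    (∫ u in (0 : ℝ)..x, φ u) ^ 2 = ∫ v in (0 : ℝ)..x, 2 * ∫ u in (0 : ℝ)..v, φ u * φ v := by
  have hd : ∀ v, HasDerivAt (fun v => ∫ u in (0 : ℝ)..v, φ u) (φ v) v := fun v =>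
    intervalIntegral.integral_hasDerivAt_right (hφ.intervalIntegrable _ _)
      hφ.aestronglyMeasurable.stronglyMeasurableAtFilter hφ.continuousAt
  have hc : Continuous fun v => ∫ u in (0 : ℝ)..v, φ u :=
    continuous_iff_continuousAt.2 fun v => (hd v).continuousAt
  simp_rw [intervalIntegral.integral_mul_const]
  have := intervalIntegral.integral_eq_sub_of_hasDerivAt (a := 0) (b := x)
    (f := fun v => (∫ u in (0 : ℝ)..v, φ u) ^ 2)
    (f' := fun v => 2 * ((∫ u in (0 : ℝ)..v, φ u) * φ v))
    (fun v _ => ((hd v).pow 2).congr_deriv (by norm_num; ring))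
    (Continuous.intervalIntegrable (by fun_prop) _ _)
  rw [this]
  simp

lemma intervalIntegral_swap_of_continuous {f : ℝ → ℝ → ℝ} (hf : Continuous (Function.uncurry f))
    (a b c d : ℝ) :
    ∫ x in a..b, ∫ y in c..d, f x y = ∫ y in c..d, ∫ x in a..b, f x y := by
  refine intervalIntegral_intervalIntegral_swap ?_
  exact (hf.continuousOn.integrableOn_compact (isCompact_uIcc.prod isCompact_uIcc)).mono_set
    (prod_mono uIoc_subset_uIcc uIoc_subset_uIcc)

lemma integral_sq_primitive {h : ℝ → ℝ → ℝ} (hh : Continuous (Function.uncurry h)) :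
    ∫ x in (0 : ℝ)..1, ∫ y in (0 : ℝ)..1, (∫ u in (0 : ℝ)..x, h u y) ^ 2 =
      ∫ x in (0 : ℝ)..1, ∫ v in (0 : ℝ)..x, 2 * ∫ u in (0 : ℝ)..v,
        ∫ y in (0 : ℝ)..1, h u y * h v y := by
  refine intervalIntegral.integral_congr fun x _ => ?_
  have hy : ∀ y, Continuous fun u => h u y := fun y => by fun_prop
  simp_rw [fun y => sq_integral_eq (hy y) x]
  rw [intervalIntegral_swap_of_continuous]
  · refine intervalIntegral.integral_congr fun v _ => ?_
    simp only [intervalIntegral.integral_const_mul]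
    rw [intervalIntegral_swap_of_continuous]
    simp only [Function.uncurry_def]
    fun_prop
  · simp only [Function.uncurry_def]
    refine continuous_const.mul ?_
    apply intervalIntegral.continuous_parametric_intervalIntegral_of_continuous
    · simp only [Function.uncurry_def]
      fun_prop
    · fun_prop

lemma integral_sq_tent_nonneg_slope {m : ℝ} (h0 : 0 ≤ m) (h1 : m ≤ 1) :
    ∫ x in (0 : ℝ)..1, ∫ y in (0 : ℝ)..1,
      (∫ u in (0 : ℝ)..x, (midline m u - |y - midline m u|)) ^ 2 =
      1 / 36 - m / 48 - m ^ 2 / 120 + m ^ 3 / 80 := by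
  have hm : m ∈ Icc (-1 : ℝ) 1 := ⟨by linarith, h1⟩
  rw [integral_sq_primitive (by simp only [Function.uncurry_def]; fun_prop)]
  have e1 : ∀ v ∈ Icc (0 : ℝ) 1, ∫ u in (0 : ℝ)..v, ∫ y in (0 : ℝ)..1,
      (midline m u - |y - midline m u|) * (midline m v - |y - midline m v|) =
      (1 / 12 - m / 4 + m ^ 2 / 4 + m ^ 3 / 4) * v
        + (3 / 8 * m - 3 / 4 * m ^ 2 - 9 / 8 * m ^ 3) * v ^ 2
        + (m ^ 2 / 3 + 5 / 3 * m ^ 3) * v ^ 3 + (-3 / 4 * m ^ 3) * v ^ 4 := by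
    intro v hv
    rw [intervalIntegral.integral_congr (g := fun u =>
      (-(1 / 2 - m / 2) ^ 3 / 3 - 2 * (1 / 2 - m / 2) * midline m v ^ 2 + midline m v ^ 3 / 3
        + 4 * (1 / 2 - m / 2) * midline m v - (1 / 2 - m / 2) - midline m v + 1 / 3)
      + (-(1 / 2 - m / 2) ^ 2 * m - 2 * m * midline m v ^ 2 + 4 * m * midline m v - m) * u
      + (-(1 / 2 - m / 2) * m ^ 2) * u ^ 2 + (-m ^ 3 / 3) * u ^ 3 + 0 * u ^ 4 + 0 * u ^ 5),
      integral_quintic]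
    · unfold midline
      ring
    · intro u hu
      rw [uIcc_of_le hv.1] at hu
      simp only
      rw [integral_tent_mul_tent (midline_mem_Icc hm ⟨hu.1, hu.2.trans hv.2⟩).1 _
        (midline_mem_Icc hm hv).2]
      · unfold midline
        ring
      · unfold midline
        nlinarith [hu.2]
  rw [intervalIntegral.integral_congr (g := fun x =>
    0 + 0 * x + (1 / 12 - m / 4 + m ^ 2 / 4 + m ^ 3 / 4) * x ^ 2
        + (m / 4 - m ^ 2 / 2 - 3 / 4 * m ^ 3) * x ^ 3
        + (m ^ 2 / 6 + 5 / 6 * m ^ 3) * x ^ 4 + (-3 / 10 * m ^ 3) * x ^ 5), integral_quintic]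
  · ring
  intro x hx
  rw [uIcc_of_le zero_le_one] at hx
  simp only
  rw [intervalIntegral.integral_congr (g := fun v =>
    0 + (2 * (1 / 12 - m / 4 + m ^ 2 / 4 + m ^ 3 / 4)) * v
        + (2 * (3 / 8 * m - 3 / 4 * m ^ 2 - 9 / 8 * m ^ 3)) * v ^ 2
        + (2 * (m ^ 2 / 3 + 5 / 3 * m ^ 3)) * v ^ 3 + (2 * (-3 / 4 * m ^ 3)) * v ^ 4
        + 0 * v ^ 5), integral_quintic]
  · ring
  intro v hv
  rw [uIcc_of_le hx.1] at hv
  simp only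
  rw [e1 v ⟨hv.1, hv.2.trans hx.2⟩]
  ring

lemma integral_sq_tent_nonpos_slope {m : ℝ} (h0 : -1 ≤ m) (h1 : m ≤ 0) :
    ∫ x in (0 : ℝ)..1, ∫ y in (0 : ℝ)..1,
      (∫ u in (0 : ℝ)..x, (midline m u - |y - midline m u|)) ^ 2 =
      1 / 36 - m / 48 - m ^ 2 / 120 + m ^ 3 / 720 := by
  have hm : m ∈ Icc (-1 : ℝ) 1 := ⟨h0, by linarith⟩
  rw [integral_sq_primitive (by simp only [Function.uncurry_def]; fun_prop)]
  have e1 : ∀ v ∈ Icc (0 : ℝ) 1, ∫ u in (0 : ℝ)..v, ∫ y in (0 : ℝ)..1,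
      (midline m u - |y - midline m u|) * (midline m v - |y - midline m v|) =
      (1 / 12 - m / 4 + m ^ 2 / 4 + m ^ 3 / 4) * v
        + (3 / 8 * m - 3 / 4 * m ^ 2 - 9 / 8 * m ^ 3) * v ^ 2
        + (m ^ 2 / 3 + 5 / 3 * m ^ 3) * v ^ 3 + (-11 / 12 * m ^ 3) * v ^ 4 := by
    intro v hv
    rw [intervalIntegral.integral_congr (g := fun u =>
      (-midline m v ^ 3 / 3 - 2 * midline m v * (1 / 2 - m / 2) ^ 2 + (1 / 2 - m / 2) ^ 3 / 3
        + 4 * midline m v * (1 / 2 - m / 2) - midline m v - (1 / 2 - m / 2) + 1 / 3)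
      + (-4 * midline m v * (1 / 2 - m / 2) * m + (1 / 2 - m / 2) ^ 2 * m
        + 4 * midline m v * m - m) * u
      + (-2 * midline m v * m ^ 2 + (1 / 2 - m / 2) * m ^ 2) * u ^ 2
      + (m ^ 3 / 3) * u ^ 3 + 0 * u ^ 4 + 0 * u ^ 5),
      integral_quintic]
    · unfold midline
      ring
    · intro u hu
      rw [uIcc_of_le hv.1] at hu
      simp only
      rw [intervalIntegral.integral_congr fun y _ => mul_comm _ _,
        integral_tent_mul_tent (midline_mem_Icc hm hv).1 _
        (midline_mem_Icc hm ⟨hu.1, hu.2.trans hv.2⟩).2]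
      · unfold midline
        ring
      · unfold midline
        nlinarith [hu.2]
  rw [intervalIntegral.integral_congr (g := fun x =>
    0 + 0 * x + (1 / 12 - m / 4 + m ^ 2 / 4 + m ^ 3 / 4) * x ^ 2
        + (m / 4 - m ^ 2 / 2 - 3 / 4 * m ^ 3) * x ^ 3
        + (m ^ 2 / 6 + 5 / 6 * m ^ 3) * x ^ 4 + (-11 / 30 * m ^ 3) * x ^ 5), integral_quintic]
  · ring
  intro x hx
  rw [uIcc_of_le zero_le_one] at hx
  simp only
  rw [intervalIntegral.integral_congr (g := fun v =>
    0 + (2 * (1 / 12 - m / 4 + m ^ 2 / 4 + m ^ 3 / 4)) * v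
        + (2 * (3 / 8 * m - 3 / 4 * m ^ 2 - 9 / 8 * m ^ 3)) * v ^ 2
        + (2 * (m ^ 2 / 3 + 5 / 3 * m ^ 3)) * v ^ 3 + (2 * (-11 / 12 * m ^ 3)) * v ^ 4
        + 0 * v ^ 5), integral_quintic]
  · ring
  intro v hv
  rw [uIcc_of_le hx.1] at hv
  simp only
  rw [e1 v ⟨hv.1, hv.2.trans hx.2⟩]
  ring

lemma integral_sq_tent_le {m : ℝ} (hm : m ∈ Icc (-1 : ℝ) 1) :
    ∫ x in (0 : ℝ)..1, ∫ y in (0 : ℝ)..1,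
      (∫ u in (0 : ℝ)..x, (midline m u - |y - midline m u|)) ^ 2 ≤ 7 / 180 := by
  obtain ⟨h1, h2⟩ := hm
  rcases le_total 0 m with h0 | h0
  · rw [integral_sq_tent_nonneg_slope h0 h2]
    nlinarith [mul_nonneg h0 (sub_nonneg.2 h2), mul_nonneg (mul_nonneg h0 h0) (sub_nonneg.2 h2)]
  · rw [integral_sq_tent_nonpos_slope h1 h0]
    nlinarith [mul_nonneg (neg_nonneg.2 h0) (sub_nonneg.2 h1),
      mul_nonneg (mul_nonneg (neg_nonneg.2 h0) (neg_nonneg.2 h0)) (sub_nonneg.2 h1)]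

lemma setIntegral_Icc_fin_two {F : (Fin 2 → ℝ) → ℝ} (hF : IntegrableOn F (Icc 0 1)) :
    ∫ x in Icc (0 : Fin 2 → ℝ) 1, F x = ∫ x in (0 : ℝ)..1, ∫ y in (0 : ℝ)..1, F ![x, y] := by
  have hp := (volume_preserving_finTwoArrow ℝ).symm
  have hpre : (MeasurableEquiv.finTwoArrow (α := ℝ)).symm ⁻¹' (Icc (0 : Fin 2 → ℝ) 1) =
      Icc (0 : ℝ) 1 ×ˢ Icc (0 : ℝ) 1 := by
    ext p
    simp only [MeasurableEquiv.finTwoArrow, mem_preimage, mem_Icc, Pi.le_def, Fin.forall_fin_two,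
      mem_prod]
    exact and_and_and_comm
  have hI : IntegrableOn (fun p : ℝ × ℝ => F ![p.1, p.2]) (Icc (0 : ℝ) 1 ×ˢ Icc (0 : ℝ) 1)
      (volume.prod volume) := by
    have := (hp.integrableOn_comp_preimage (MeasurableEquiv.measurableEmbedding _)).2 hF
    rw [hpre] at this
    exact this
  rw [← hp.setIntegral_preimage_emb (MeasurableEquiv.measurableEmbedding _), hpre,
    Measure.volume_eq_prod]
  change ∫ p in Icc (0 : ℝ) 1 ×ˢ Icc (0 : ℝ) 1, F ![p.1, p.2] ∂(volume.prod volume) = _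
  rw [setIntegral_prod _ hI]
  simp_rw [intervalIntegral.integral_of_le zero_le_one, ← integral_Icc_eq_integral_Ioc]

lemma measureReal_subgraph_inter_box {l : ℝ → ℝ} (hl : Continuous l) {x y : ℝ} (hx : 0 ≤ x)
    (hy : 0 ≤ y) (hl0 : ∀ u ∈ Icc 0 x, 0 ≤ l u) :
    volume.real ({p : Fin 2 → ℝ | p 1 ≤ l (p 0)} ∩ box 2 ![x, y]) =
      ∫ u in (0 : ℝ)..x, min y (l u) := by
  have hp := (volume_preserving_finTwoArrow ℝ)
  set S : Set (ℝ × ℝ) := {p | p.2 ≤ l p.1 ∧ p.1 ∈ Ico 0 x ∧ p.2 ∈ Ico 0 y} with hS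
  have hSm : MeasurableSet S := by
    refine (measurableSet_le measurable_snd (hl.measurable.comp measurable_fst)).inter ?_
    exact (measurable_fst measurableSet_Ico).inter (measurable_snd measurableSet_Ico)
  have hpre : {p : Fin 2 → ℝ | p 1 ≤ l (p 0)} ∩ box 2 ![x, y] =
      MeasurableEquiv.finTwoArrow ⁻¹' S := by
    ext p
    simp [box, hS, MeasurableEquiv.finTwoArrow, Fin.forall_fin_two]
  have hslice : ∀ u ∈ Ico 0 x, volume (Prod.mk u ⁻¹' S) = ENNReal.ofReal (min y (l u)) := by
    intro u hu
    refine le_antisymm ?_ ?_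
    · calc volume (Prod.mk u ⁻¹' S) ≤ volume (Icc 0 (min y (l u))) := by
            refine measure_mono fun v hv => ?_
            exact ⟨hv.2.2.1, le_min hv.2.2.2.le hv.1⟩
        _ = _ := by rw [Real.volume_Icc, sub_zero]
    · calc ENNReal.ofReal (min y (l u)) = volume (Ico 0 (min y (l u))) := by
            rw [Real.volume_Ico, sub_zero]
        _ ≤ _ := by
            refine measure_mono fun v hv => ?_
            exact ⟨(hv.2.trans_le (min_le_right _ _)).le, hu, hv.1,
              hv.2.trans_le (min_le_left _ _)⟩
  have hslice' : (fun u => volume (Prod.mk u ⁻¹' S)) =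
      (Ico 0 x).indicator fun u => ENNReal.ofReal (min y (l u)) := by
    funext u
    by_cases hu : u ∈ Ico 0 x
    · rw [indicator_of_mem hu, hslice u hu]
    · rw [indicator_of_notMem hu]
      convert measure_empty (μ := (volume : Measure ℝ))
      ext v
      simp only [hS, mem_preimage, mem_ofPred_eq, mem_empty_iff_false, iff_false]
      tauto
  have hc : Continuous fun u => min y (l u) := by fun_prop
  rw [measureReal_def, hpre, hp.measure_preimage hSm.nullMeasurableSet, Measure.volume_eq_prod,
    Measure.prod_apply hSm, hslice', lintegral_indicator measurableSet_Ico,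
    ← ofReal_integral_eq_lintegral_ofReal, ENNReal.toReal_ofReal, integral_Ico_eq_integral_Ioc,
    intervalIntegral.integral_of_le hx]
  · exact setIntegral_nonneg measurableSet_Ico fun u hu => le_min hy (hl0 u ⟨hu.1, hu.2.le⟩)
  · exact (hc.integrableOn_Icc).mono_set Ico_subset_Icc_self
  · exact (ae_restrict_mem measurableSet_Ico).mono
      fun u hu => le_min hy (hl0 u ⟨hu.1, hu.2.le⟩)

lemma measureReal_box {x : Fin 2 → ℝ} (hx : 0 ≤ x) : volume.real (box 2 x) = x 0 * x 1 := by
  rw [measureReal_def, box, Real.volume_pi_Ico]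
  simp [Fin.prod_univ_two, ENNReal.toReal_ofReal (hx 0), ENNReal.toReal_ofReal (hx 1)]

lemma measurableSet_box (d : ℕ) (x : Fin d → ℝ) : MeasurableSet (box d x) :=
  MeasurableSet.univ_pi fun _ => measurableSet_Ico

lemma box_subset_Icc {d : ℕ} {x : Fin d → ℝ} (hx : x ≤ 1) : box d x ⊆ Icc 0 1 :=
  fun _ hp => ⟨fun i => (hp i trivial).1, fun i => (hp i trivial).2.le.trans (hx i)⟩

lemma measurableSet_setOf_mem_box (d : ℕ) :
    MeasurableSet {q : (Fin d → ℝ) × (Fin d → ℝ) | q.2 ∈ box d q.1} := by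
  simp only [box, mem_univ_pi, mem_Ico, ofPred_forall, ofPred_and]
  refine MeasurableSet.iInter fun i => MeasurableSet.inter ?_ ?_
  · exact measurableSet_le (by fun_prop) (by fun_prop)
  · exact measurableSet_lt (by fun_prop) (by fun_prop)

lemma volume_Icc_fin_two : volume (Icc (0 : Fin 2 → ℝ) 1) = 1 := by
  simp [Real.volume_Icc_pi]

/-- The signed difference of the areas of the two parts of the box `[0,x)` cut out by `A`
and its complement. -/
noncomputable def imbalance (A : Set (Fin 2 → ℝ)) (x : Fin 2 → ℝ) : ℝ :=
  2 * volume.real (A ∩ box 2 x) - x 0 * x 1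

lemma measurable_imbalance {A : Set (Fin 2 → ℝ)} (hA : MeasurableSet A) :
    Measurable (imbalance A) := by
  have : Measurable fun x : Fin 2 → ℝ => volume (A ∩ box 2 x) :=
    measurable_measure_prodMk_left (ν := (volume : Measure (Fin 2 → ℝ)))
      ((measurable_snd hA).inter (measurableSet_setOf_mem_box 2))
  unfold imbalance
  simp only [measureReal_def]
  have := this.ennreal_toReal
  fun_prop

lemma abs_imbalance_le {A : Set (Fin 2 → ℝ)} {x : Fin 2 → ℝ}
    (hx : x ∈ Icc (0 : Fin 2 → ℝ) 1) : |imbalance A x| ≤ 1 := by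
  have h1 : volume.real (A ∩ box 2 x) ≤ volume.real (box 2 x) := by
    refine measureReal_mono inter_subset_right (ne_of_lt ?_)
    exact (measure_mono (box_subset_Icc hx.2)).trans_lt (by simp [volume_Icc_fin_two])
  have h2 : 0 ≤ volume.real (A ∩ box 2 x) := measureReal_nonneg
  rw [measureReal_box hx.1] at h1
  have h3 := hx.1 0
  have h4 := hx.1 1
  have h5 := hx.2 0
  have h6 := hx.2 1
  simp only [Pi.zero_apply, Pi.one_apply] at h3 h4 h5 h6
  have h7 : x 0 * x 1 ≤ 1 := by nlinarith
  unfold imbalance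
  rw [abs_le]
  constructor <;> linarith

lemma integrableOn_sq_imbalance {A : Set (Fin 2 → ℝ)} (hA : MeasurableSet A) :
    IntegrableOn (fun x => imbalance A x ^ 2) (Icc 0 1) := by
  refine Measure.integrableOn_of_bounded (M := 1) (by simp [volume_Icc_fin_two])
    ((measurable_imbalance hA).pow_const 2).aestronglyMeasurable ?_
  refine (ae_restrict_mem measurableSet_Icc).mono fun x hx => ?_
  have := abs_imbalance_le (A := A) hx
  rw [Real.norm_eq_abs, abs_pow]
  exact pow_le_one₀ (abs_nonneg _) this

lemma integral_sq_imbalance_midline {m : ℝ} (hm : m ∈ Icc (-1 : ℝ) 1) :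
    ∫ x in Icc 0 1, imbalance {p | p 1 ≤ midline m (p 0)} x ^ 2 =
      ∫ x in (0 : ℝ)..1, ∫ y in (0 : ℝ)..1,
        (∫ u in (0 : ℝ)..x, (midline m u - |y - midline m u|)) ^ 2 := by
  rw [setIntegral_Icc_fin_two (integrableOn_sq_imbalance
    (measurableSet_le (by fun_prop) (by fun_prop)))]
  refine intervalIntegral.integral_congr fun x hx => ?_
  refine intervalIntegral.integral_congr fun y hy => ?_
  rw [uIcc_of_le zero_le_one] at hx hy
  congr 1
  rw [imbalance, measureReal_subgraph_inter_box (continuous_midline m) hx.1 hy.1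
    fun u hu => (midline_mem_Icc hm ⟨hu.1, hu.2.trans hx.2⟩).1]
  have : x * y = ∫ u in (0 : ℝ)..x, y := by simp
  simp only [Matrix.cons_val_zero, Matrix.cons_val_one]
  rw [this, ← intervalIntegral.integral_const_mul, ← intervalIntegral.integral_sub
    (Continuous.intervalIntegrable (by fun_prop) _ _)
    (Continuous.intervalIntegrable (by fun_prop) _ _)]
  refine intervalIntegral.integral_congr fun u _ => ?_
  rcases le_total y (midline m u) with h | h
  · simp only [min_eq_left h, abs_of_nonpos (sub_nonpos.2 h)]
    ring
  · simp only [min_eq_right h, abs_of_nonneg (sub_nonneg.2 h)]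
    ring

lemma isProbabilityMeasure_unif {d : ℕ} {A : Set (Fin d → ℝ)} (h0 : volume A ≠ 0)
    (h1 : volume A ≠ ∞) : IsProbabilityMeasure (unif A) :=
  ⟨by simp [unif, ENNReal.inv_mul_cancel h0 h1]⟩

lemma ncard_setOf_mem_box {d N : ℕ} (P : Fin N → Fin d → ℝ) (x : Fin d → ℝ) :
    ({i | P i ∈ box d x}.ncard : ℝ) = ∑ i, (box d x).indicator 1 (P i) := by
  classical
  rw [Set.ncard_eq_toFinset_card']
  simp [Set.indicator_apply, Finset.sum_boole]

lemma unif_real_apply {d : ℕ} {A B : Set (Fin d → ℝ)} (hA : volume A = 1 / 2)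
    (hB : MeasurableSet B) : (unif A).real B = 2 * volume.real (A ∩ B) := by
  simp [unif, measureReal_def, hA, Measure.restrict_apply hB, inter_comm]

lemma integral_sq_count_sub {Ω : Fin 2 → Set (Fin 2 → ℝ)} (hv : ∀ i, volume (Ω i) = 1 / 2)
    {x : Fin 2 → ℝ}
    (hadd : volume.real (Ω 0 ∩ box 2 x) + volume.real (Ω 1 ∩ box 2 x) = x 0 * x 1) :
    ∫ P : Fin 2 → Fin 2 → ℝ, ((∑ i, (box 2 x).indicator 1 (P i)) / 2 - x 0 * x 1) ^ 2
      ∂(Measure.pi fun i => unif (Ω i)) =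
      x 0 * x 1 / 2 - (x 0 * x 1) ^ 2 / 2 - 1 / 2 * imbalance (Ω 0) x ^ 2 := by
  have : ∀ i, IsProbabilityMeasure (unif (Ω i)) := fun i =>
    isProbabilityMeasure_unif (by simp [hv]) (by simp [hv])
  set μ := Measure.pi fun i => unif (Ω i) with hμ
  set B := box 2 x with hB
  have hBm : MeasurableSet B := measurableSet_box 2 x
  set v := x 0 * x 1 with hvdef
  have hS : ∀ i : Fin 2, MeasurableSet (Function.eval i ⁻¹' B : Set (Fin 2 → Fin 2 → ℝ)) :=
    fun i => (measurable_pi_apply i) hBm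
  have hE : ∀ i : Fin 2, μ.real (Function.eval i ⁻¹' B) = 2 * volume.real (Ω i ∩ B) := by
    intro i
    rw [← unif_real_apply (hv i) hBm, measureReal_def, measureReal_def,
      (measurePreserving_eval (fun i => unif (Ω i)) i).measure_preimage hBm.nullMeasurableSet]
  have hE2 : μ.real (Function.eval 0 ⁻¹' B ∩ Function.eval 1 ⁻¹' B) =
      (2 * volume.real (Ω 0 ∩ B)) * (2 * volume.real (Ω 1 ∩ B)) := by
    have : (Function.eval 0 ⁻¹' B ∩ Function.eval 1 ⁻¹' B : Set (Fin 2 → Fin 2 → ℝ)) =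
        univ.pi fun _ => B := by
      ext P
      simp [Fin.forall_fin_two]
    rw [this, measureReal_def, hμ, Measure.pi_pi, Fin.prod_univ_two, ENNReal.toReal_mul,
      ← measureReal_def, ← measureReal_def, unif_real_apply (hv 0) hBm,
      unif_real_apply (hv 1) hBm]
  have hexp : (fun P : Fin 2 → Fin 2 → ℝ => ((∑ i, B.indicator 1 (P i)) / 2 - v) ^ 2) =
      fun P => (1 / 4 - v) * (Function.eval 0 ⁻¹' B).indicator 1 P
        + (1 / 4 - v) * (Function.eval 1 ⁻¹' B).indicator 1 P
        + 1 / 2 * (Function.eval 0 ⁻¹' B ∩ Function.eval 1 ⁻¹' B).indicator 1 P + v ^ 2 := by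
    funext P
    by_cases h0 : P 0 ∈ B <;> by_cases h1 : P 1 ∈ B <;>
      simp [Fin.sum_univ_two, h0, h1] <;> ring
  have hint : ∀ S : Set (Fin 2 → Fin 2 → ℝ), MeasurableSet S →
      Integrable (S.indicator (1 : (Fin 2 → Fin 2 → ℝ) → ℝ)) μ := fun S hS =>
    (integrable_const 1).indicator hS
  have i0 := hint _ (hS 0)
  have i1 := hint _ (hS 1)
  have i2 := hint _ ((hS 0).inter (hS 1))
  have j01 : Integrable (fun P => (1 / 4 - v) * (Function.eval 0 ⁻¹' B).indicator 1 P
      + (1 / 4 - v) * (Function.eval 1 ⁻¹' B).indicator 1 P) μ :=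
    (i0.const_mul _).add (i1.const_mul _)
  have j012 : Integrable (fun P => (1 / 4 - v) * (Function.eval 0 ⁻¹' B).indicator 1 P
      + (1 / 4 - v) * (Function.eval 1 ⁻¹' B).indicator 1 P
      + 1 / 2 * (Function.eval 0 ⁻¹' B ∩ Function.eval 1 ⁻¹' B).indicator 1 P) μ :=
    j01.add (i2.const_mul _)
  rw [hexp, integral_add j012 (integrable_const _), integral_add j01 (i2.const_mul _),
    integral_add (i0.const_mul _) (i1.const_mul _), integral_const_mul, integral_const_mul,
    integral_const_mul, integral_indicator_one (hS 0), integral_indicator_one (hS 1),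
    integral_indicator_one ((hS 0).inter (hS 1)), hE, hE, hE2, imbalance, ← hvdef, ← hB]
  have h1 : volume.real (Ω 1 ∩ B) = v - volume.real (Ω 0 ∩ B) := by linarith
  rw [h1]
  simp
  ring

lemma meanDisc2_eq {Ω : Fin 2 → Set (Fin 2 → ℝ)} (hm : MeasurableSet (Ω 0))
    (hv : ∀ i, volume (Ω i) = 1 / 2)
    (hadd : ∀ x ∈ Icc (0 : Fin 2 → ℝ) 1,
      volume.real (Ω 0 ∩ box 2 x) + volume.real (Ω 1 ∩ box 2 x) = x 0 * x 1) :
    meanDisc2 Ω = 5 / 72 - 1 / 2 * ∫ x in Icc 0 1, imbalance (Ω 0) x ^ 2 := by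
  have : ∀ i, IsProbabilityMeasure (unif (Ω i)) := fun i =>
    isProbabilityMeasure_unif (by simp [hv]) (by simp [hv])
  have : IsFiniteMeasure (volume.restrict (Icc (0 : Fin 2 → ℝ) 1)) :=
    ⟨by simp [volume_Icc_fin_two]⟩
  have hdisc : ∀ P : Fin 2 → Fin 2 → ℝ, disc2 2 2 P = ∫ x in Icc (0 : Fin 2 → ℝ) 1,
      ((∑ i, (box 2 x).indicator 1 (P i)) / 2 - x 0 * x 1) ^ 2 := by
    intro P
    refine setIntegral_congr_fun measurableSet_Icc fun x hx => ?_
    rw [ncard_setOf_mem_box, ← measureReal_def, measureReal_box hx.1]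
    norm_num
  unfold meanDisc2
  simp_rw [hdisc]
  rw [integral_integral_swap]
  · rw [setIntegral_congr_fun measurableSet_Icc
      fun x hx => integral_sq_count_sub hv (hadd x hx)]
    have c1 : IntegrableOn (fun x : Fin 2 → ℝ => x 0 * x 1 / 2 - (x 0 * x 1) ^ 2 / 2)
        (Icc 0 1) := (by fun_prop : Continuous _).continuousOn.integrableOn_compact isCompact_Icc
    rw [integral_sub c1 ((integrableOn_sq_imbalance hm).const_mul _), integral_const_mul,
      setIntegral_Icc_fin_two c1]
    congr 1
    have e : ∀ x : ℝ, ∫ y in (0 : ℝ)..1, (![x, y] 0 * ![x, y] 1 / 2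
        - (![x, y] 0 * ![x, y] 1) ^ 2 / 2) = x / 4 - x ^ 2 / 6 := by
      intro x
      rw [intervalIntegral.integral_congr (g := fun y => 0 + x / 2 * y + (-x ^ 2 / 2) * y ^ 2
        + 0 * y ^ 3 + 0 * y ^ 4 + 0 * y ^ 5), integral_quintic]
      · ring
      · intro y _
        simp
        ring
    simp_rw [e]
    rw [intervalIntegral.integral_congr (g := fun y => 0 + 1 / 4 * y + (-1 / 6) * y ^ 2
        + 0 * y ^ 3 + 0 * y ^ 4 + 0 * y ^ 5), integral_quintic]
    · norm_num
    · intro y _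
      simp only
      ring
  · refine Integrable.of_bound (C := 4) ?_ ?_
    · refine Measurable.aestronglyMeasurable ?_
      have hs : ∀ i : Fin 2, MeasurableSet {q : (Fin 2 → Fin 2 → ℝ) × (Fin 2 → ℝ) |
          q.1 i ∈ box 2 q.2} := fun i =>
        (by fun_prop : Measurable fun q : (Fin 2 → Fin 2 → ℝ) × (Fin 2 → ℝ) => (q.2, q.1 i))
          (measurableSet_setOf_mem_box 2)
      have hi : ∀ i : Fin 2, Measurable fun q : (Fin 2 → Fin 2 → ℝ) × (Fin 2 → ℝ) =>
          (box 2 q.2).indicator (1 : (Fin 2 → ℝ) → ℝ) (q.1 i) := fun i =>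
        measurable_const.indicator (hs i)
      simp only [Function.uncurry_def]
      fun_prop
    · have hQ : ∀ᵐ q ∂((Measure.pi fun i => unif (Ω i)).prod
          (volume.restrict (Icc (0 : Fin 2 → ℝ) 1))), q.2 ∈ Icc (0 : Fin 2 → ℝ) 1 :=
        Measure.quasiMeasurePreserving_snd.ae (ae_restrict_mem measurableSet_Icc)
      refine hQ.mono fun q hq => ?_
      have h3 := hq.1 0
      have h4 := hq.1 1
      have h5 := hq.2 0
      have h6 := hq.2 1
      simp only [Pi.zero_apply, Pi.one_apply] at h3 h4 h5 h6
      have h7 : q.2 0 * q.2 1 ≤ 1 := by nlinarith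
      have h8 : 0 ≤ q.2 0 * q.2 1 := mul_nonneg h3 h4
      have hb : ∀ i, 0 ≤ (box 2 q.2).indicator (1 : (Fin 2 → ℝ) → ℝ) (q.1 i) ∧
          (box 2 q.2).indicator (1 : (Fin 2 → ℝ) → ℝ) (q.1 i) ≤ 1 := fun i =>
        ⟨indicator_nonneg (fun _ _ => zero_le_one) _, indicator_le_self' (by simp) _⟩
      have := hb 0
      have := hb 1
      simp only [Function.uncurry_def, Fin.sum_univ_two, Real.norm_eq_abs, abs_pow, sq_abs]
      nlinarith

lemma volume_le_of_subset_union_null {S T N : Set (Fin 2 → ℝ)} (h : S ⊆ T ∪ N)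
    (hN : volume N = 0) : volume S ≤ volume T :=
  (measure_mono h).trans ((measure_union_le T N).trans_eq (by rw [hN, add_zero]))

lemma neg_dominant_of_not_dominant {a b : ℝ} (hne : a ≠ 0 ∨ b ≠ 0)
    (h : ¬(0 < b ∧ |a| ≤ b ∨ 0 < a ∧ |b| ≤ a)) :
    0 < -b ∧ |a| ≤ -b ∨ 0 < -a ∧ |b| ≤ -a := by
  rcases le_total |a| |b| with hab | hab
  · rcases lt_trichotomy b 0 with hb | hb | hb
    · exact Or.inl ⟨neg_pos.2 hb, abs_of_neg hb ▸ hab⟩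
    · exact absurd (abs_nonpos_iff.1 (by simpa [hb] using hab)) (hne.resolve_right (by simp [hb]))
    · exact absurd (Or.inl ⟨hb, abs_of_pos hb ▸ hab⟩) h
  · rcases lt_trichotomy a 0 with ha | ha | ha
    · exact Or.inr ⟨neg_pos.2 ha, abs_of_neg ha ▸ hab⟩
    · exact absurd (abs_nonpos_iff.1 (by simpa [ha] using hab)) (hne.resolve_left (by simp [ha]))
    · exact absurd (Or.inr ⟨ha, abs_of_pos ha ▸ hab⟩) h

lemma integral_sq_imbalance_congr {A B : Set (Fin 2 → ℝ)}
    (h : ∀ x ∈ Icc (0 : Fin 2 → ℝ) 1, volume (A ∩ box 2 x) = volume (B ∩ box 2 x)) :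
    ∫ x in Icc 0 1, imbalance A x ^ 2 = ∫ x in Icc 0 1, imbalance B x ^ 2 := by
  refine setIntegral_congr_fun measurableSet_Icc fun x hx => ?_
  simp only [imbalance, measureReal_def, h x hx]

lemma integral_sq_imbalance_swap (A : Set (Fin 2 → ℝ)) :
    ∫ x in Icc 0 1, imbalance {p | ![p 1, p 0] ∈ A} x ^ 2 = ∫ x in Icc 0 1, imbalance A x ^ 2 := by
  set s := MeasurableEquiv.piCongrLeft (fun _ : Fin 2 => ℝ) (Equiv.swap 0 1) with hs
  have hp : MeasurePreserving s volume volume :=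
    volume_measurePreserving_piCongrLeft (fun _ : Fin 2 => ℝ) (Equiv.swap 0 1)
  have hsx : ∀ p, s p = ![p 1, p 0] := by
    intro p
    funext i
    fin_cases i <;> rfl
  rw [← hp.setIntegral_preimage_emb s.measurableEmbedding (fun x => imbalance A x ^ 2)]
  have hQ : s ⁻¹' (Icc (0 : Fin 2 → ℝ) 1) = Icc 0 1 := by
    ext p
    simp only [mem_preimage, hsx, mem_Icc, Pi.le_def, Fin.forall_fin_two]
    simp
    tauto
  rw [hQ]
  refine setIntegral_congr_fun measurableSet_Icc fun x hx => ?_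
  simp only [imbalance, measureReal_def]
  rw [← hp.measure_preimage_equiv (A ∩ box 2 (s x))]
  have : s ⁻¹' (A ∩ box 2 (s x)) = {p | ![p 1, p 0] ∈ A} ∩ box 2 x := by
    ext p
    simp [hsx, box, Fin.forall_fin_two]
    tauto
  rw [this, hsx]
  simp [mul_comm]

lemma integral_sq_imbalance_halfplane_le {a b : ℝ} (hab : 0 < b ∧ |a| ≤ b ∨ 0 < a ∧ |b| ≤ a) :
    ∫ x in Icc 0 1, imbalance {p | a * p 0 + b * p 1 ≤ (a + b) / 2} x ^ 2 ≤ 7 / 180 := by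
  wlog h : 0 < b ∧ |a| ≤ b generalizing a b
  · have := this hab.symm (hab.resolve_left h)
    rw [← integral_sq_imbalance_swap] at this
    convert this using 8 with x p
    simp
    rw [add_comm, add_comm a b]
  obtain ⟨hb, ha⟩ := h
  have hm : -a / b ∈ Icc (-1 : ℝ) 1 := by
    rw [abs_le] at ha
    constructor
    · rw [le_div_iff₀ hb]; linarith
    · rw [div_le_iff₀ hb]; linarith
  have hset : {p : Fin 2 → ℝ | a * p 0 + b * p 1 ≤ (a + b) / 2} =
      {p | p 1 ≤ midline (-a / b) (p 0)} := by
    ext p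
    have : midline (-a / b) (p 0) = ((a + b) / 2 - a * p 0) / b := by
      unfold midline
      field_simp
      ring
    simp only [mem_ofPred_eq, this, le_div_iff₀ hb]
    constructor <;> intro h <;> linarith
  rw [hset, integral_sq_imbalance_midline hm]
  exact integral_sq_tent_le hm

lemma measurePreserving_one_sub :
    MeasurePreserving (fun p : Fin 2 → ℝ => 1 - p) volume volume :=
  Measure.measurePreserving_sub_left volume 1

lemma one_sub_preimage_Icc : (fun p : Fin 2 → ℝ => 1 - p) ⁻¹' Icc 0 1 = Icc 0 1 := by
  ext p
  simp

/-- A linear functional whose superlevel set fills at least half of the unit square takes at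
least that level at the center. -/
lemma two_mul_level_le {f : (Fin 2 → ℝ) →L[ℝ] ℝ} {c : ℝ}
    (h : 1 / 2 ≤ volume (Icc (0 : Fin 2 → ℝ) 1 ∩ {p | c < f p})) : 2 * c ≤ f 1 := by
  by_contra! hlt
  set T := Icc (0 : Fin 2 → ℝ) 1 ∩ {p | c < f p} with hT
  have hTm : MeasurableSet T :=
    measurableSet_Icc.inter (measurableSet_lt measurable_const f.continuous.measurable)
  set T' := (fun p : Fin 2 → ℝ => 1 - p) ⁻¹' T with hT'
  have hT'v : volume T' = volume T :=
    measurePreserving_one_sub.measure_preimage hTm.nullMeasurableSet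
  have hT'm : MeasurableSet T' := measurePreserving_one_sub.measurable hTm
  set U : Set (Fin 2 → ℝ) := (univ.pi fun _ => Ioo 0 1) ∩ {p | f 1 - c < f p ∧ f p < c} with hU
  have hUo : IsOpen U := by
    refine (isOpen_set_pi finite_univ fun _ _ => isOpen_Ioo).inter ?_
    exact (isOpen_lt continuous_const f.continuous).inter (isOpen_lt f.continuous continuous_const)
  have hUne : U.Nonempty := by
    refine ⟨(1 / 2 : ℝ) • 1, fun i _ => ?_, ?_⟩
    · norm_num
    · simp only [mem_ofPred_eq, map_smul, smul_eq_mul]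
      constructor <;> linarith
  have hUpos : 0 < volume U := hUo.measure_pos volume hUne
  have hd1 : Disjoint T T' := by
    rw [disjoint_left]
    rintro p ⟨-, h1⟩ ⟨-, h2⟩
    simp only [mem_ofPred_eq, map_sub] at h1 h2
    linarith
  have hd2 : Disjoint (T ∪ T') U := by
    rw [disjoint_left]
    rintro p (⟨-, h1⟩ | ⟨-, h1⟩) ⟨-, h2, h3⟩
    · exact absurd h3 (not_lt.2 (le_of_lt h1))
    · simp only [mem_ofPred_eq, map_sub] at h1
      linarith
  have hsub : T ∪ T' ∪ U ⊆ Icc (0 : Fin 2 → ℝ) 1 := by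
    refine union_subset (union_subset inter_subset_left ?_) ?_
    · rw [← one_sub_preimage_Icc]
      exact preimage_mono inter_subset_left
    · exact fun p hp => ⟨fun i => (hp.1 i trivial).1.le, fun i => (hp.1 i trivial).2.le⟩
  have hle := measure_mono (μ := volume) hsub
  rw [measure_union hd2 hUo.measurableSet, measure_union hd1 hT'm, hT'v, volume_Icc_fin_two] at hle
  have : (1 : ℝ≥0∞) + volume U ≤ 1 := by
    refine le_trans ?_ hle
    gcongr
    rw [← ENNReal.add_halves 1]
    gcongr
  have h2 : volume U ≤ 0 := by
    rw [← ENNReal.add_le_add_iff_left (a := 1) ENNReal.one_ne_top]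
    simpa using this
  exact absurd hUpos (not_lt.2 h2)

lemma measureReal_inter_box_add {A B : Set (Fin 2 → ℝ)} (hB : MeasurableSet B)
    (hAB : A ∪ B = Icc 0 1) (hnull : volume (A ∩ B) = 0) {x : Fin 2 → ℝ}
    (hx : x ∈ Icc (0 : Fin 2 → ℝ) 1) :
    volume.real (A ∩ box 2 x) + volume.real (B ∩ box 2 x) = x 0 * x 1 := by
  have hfin : ∀ S : Set (Fin 2 → ℝ), volume (S ∩ box 2 x) ≠ ∞ := fun S =>
    ne_of_lt (((measure_mono inter_subset_right).trans
      (measure_mono (box_subset_Icc hx.2))).trans_lt (by simp [volume_Icc_fin_two]))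
  rw [← measureReal_union_add_inter (hB.inter (measurableSet_box 2 x)) (hfin A) (hfin B),
    ← union_inter_distrib_right, hAB, inter_eq_right.2 (box_subset_Icc hx.2),
    measureReal_box hx.1]
  have : volume.real (A ∩ box 2 x ∩ (B ∩ box 2 x)) = 0 := by
    rw [measureReal_def, measure_mono_null (inter_subset_inter inter_subset_left inter_subset_left) hnull]
    rfl
  rw [this, add_zero]

/-- If the interiors of two convex sets partitioning the square are strictly separated by a line
which is steep in a suitable direction, the first one has small mean square imbalance. -/
lemma integral_sq_imbalance_le_of_separated {A B : Set (Fin 2 → ℝ)} (hA : Convex ℝ A)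
    (hB : Convex ℝ B) (hAB : A ∪ B = Icc 0 1) {f : (Fin 2 → ℝ) →L[ℝ] ℝ} {c : ℝ}
    (hfA : ∀ p ∈ interior A, f p < c) (hfB : ∀ p ∈ interior B, c < f p) (hc : 2 * c = f 1)
    (hf : 0 < f (Pi.single 1 1) ∧ |f (Pi.single 0 1)| ≤ f (Pi.single 1 1) ∨
      0 < f (Pi.single 0 1) ∧ |f (Pi.single 1 1)| ≤ f (Pi.single 0 1)) :
    ∫ x in Icc 0 1, imbalance A x ^ 2 ≤ 7 / 180 := by
  have hfx : ∀ p, f p = f (Pi.single 0 1) * p 0 + f (Pi.single 1 1) * p 1 := by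
    intro p
    have : p = p 0 • Pi.single 0 1 + p 1 • Pi.single 1 1 := by
      funext i
      fin_cases i <;> simp
    conv_lhs => rw [this]
    simp [mul_comm]
  refine le_trans (le_of_eq ?_) (integral_sq_imbalance_halfplane_le hf)
  refine integral_sq_imbalance_congr fun x hx => ?_
  have hset : ∀ p, p ∈ {p : Fin 2 → ℝ | f (Pi.single 0 1) * p 0 + f (Pi.single 1 1) * p 1 ≤
      (f (Pi.single 0 1) + f (Pi.single 1 1)) / 2} ↔ f p ≤ c := by
    intro p
    have h1 := hfx 1
    simp only [Pi.one_apply, mul_one] at h1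
    rw [mem_ofPred_eq, ← hfx, ← h1, ← hc]
    simp
  refine le_antisymm ?_ ?_
  · refine volume_le_of_subset_union_null ?_ (hA.addHaar_frontier volume)
    rintro p ⟨hp, hpx⟩
    by_cases hpi : p ∈ interior A
    · exact Or.inl ⟨(hset p).2 (hfA p hpi).le, hpx⟩
    · exact Or.inr ⟨subset_closure hp, hpi⟩
  · refine volume_le_of_subset_union_null ?_ (hB.addHaar_frontier volume)
    rintro p ⟨hp, hpx⟩
    have hpQ : p ∈ A ∪ B := hAB ▸ box_subset_Icc hx.2 hpx
    rcases hpQ with hpA | hpB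
    · exact Or.inl ⟨hpA, hpx⟩
    · exact Or.inr ⟨subset_closure hpB, fun hpi => absurd ((hset p).1 hp) (not_le.2 (hfB p hpi))⟩

lemma Convex.nonempty_interior_of_volume_ne_zero {A : Set (Fin 2 → ℝ)} (hA : Convex ℝ A)
    (h0 : volume A ≠ 0) : (interior A).Nonempty := by
  by_contra h
  rw [not_nonempty_iff_eq_empty] at h
  refine h0 (measure_mono_null (fun p hp => ?_) (hA.addHaar_frontier volume))
  exact ⟨subset_closure hp, by simp [h]⟩

lemma half_le_volume_Icc_inter {A S : Set (Fin 2 → ℝ)} (hA : Convex ℝ A)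
    (hAQ : A ⊆ Icc 0 1) (hv : volume A = 1 / 2) (hS : interior A ⊆ S) :
    1 / 2 ≤ volume (Icc (0 : Fin 2 → ℝ) 1 ∩ S) := by
  rw [← hv]
  refine volume_le_of_subset_union_null ?_ (hA.addHaar_frontier volume)
  intro p hp
  by_cases hpi : p ∈ interior A
  · exact Or.inl ⟨hAQ hp, hS hpi⟩
  · exact Or.inr ⟨subset_closure hp, hpi⟩

lemma integral_sq_imbalance_le_of_convex {A B : Set (Fin 2 → ℝ)} (hA : Convex ℝ A)
    (hB : Convex ℝ B) (hBm : MeasurableSet B) (hvA : volume A = 1 / 2) (hvB : volume B = 1 / 2)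
    (hAB : A ∪ B = Icc 0 1) (hnull : volume (A ∩ B) = 0) :
    ∫ x in Icc 0 1, imbalance A x ^ 2 ≤ 7 / 180 := by
  have hAi := hA.nonempty_interior_of_volume_ne_zero (by simp [hvA])
  have hBi := hB.nonempty_interior_of_volume_ne_zero (by simp [hvB])
  have hdisj : Disjoint (interior A) (interior B) := by
    rw [disjoint_iff_inter_eq_empty]
    refine (isOpen_interior.inter isOpen_interior).eq_empty_of_measure_zero (μ := volume) ?_
    exact measure_mono_null (inter_subset_inter interior_subset interior_subset) hnull
  obtain ⟨f, c, hfA, hfB⟩ := geometric_hahn_banach_open_open hA.interior isOpen_interior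
    hB.interior isOpen_interior hdisj
  have hAQ : A ⊆ Icc 0 1 := hAB ▸ subset_union_left
  have hBQ : B ⊆ Icc 0 1 := hAB ▸ subset_union_right
  have hc : 2 * c = f 1 := by
    refine le_antisymm (two_mul_level_le (half_le_volume_Icc_inter hB hBQ hvB hfB)) ?_
    have := two_mul_level_le (f := -f) (c := -c)
      (half_le_volume_Icc_inter hA hAQ hvA fun p hp => by simpa using hfA p hp)
    simp only [neg_apply] at this
    linarith
  have hne : f (Pi.single 0 1) ≠ 0 ∨ f (Pi.single 1 1) ≠ 0 := by
    by_contra! h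
    have hf0 : ∀ p, f p = 0 := by
      intro p
      have : p = p 0 • Pi.single 0 1 + p 1 • Pi.single 1 1 := by
        funext i
        fin_cases i <;> simp
      rw [this]
      simp [h.1, h.2]
    obtain ⟨p, hp⟩ := hAi
    obtain ⟨q, hq⟩ := hBi
    have h1 := hfA p hp
    have h2 := hfB q hq
    rw [hf0] at h1 h2
    linarith
  by_cases hf : 0 < f (Pi.single 1 1) ∧ |f (Pi.single 0 1)| ≤ f (Pi.single 1 1) ∨
      0 < f (Pi.single 0 1) ∧ |f (Pi.single 1 1)| ≤ f (Pi.single 0 1)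
  · exact integral_sq_imbalance_le_of_separated hA hB hAB hfA hfB hc hf
  · have hflip : ∫ x in Icc 0 1, imbalance A x ^ 2 = ∫ x in Icc 0 1, imbalance B x ^ 2 := by
      refine setIntegral_congr_fun measurableSet_Icc fun x hx => ?_
      have := measureReal_inter_box_add hBm hAB hnull hx
      simp only [imbalance, ← this]
      ring
    rw [hflip]
    refine integral_sq_imbalance_le_of_separated hB hA (union_comm A B ▸ hAB) (f := -f) (c := -c)
      (fun p hp => by simpa using hfB p hp) (fun p hp => by simpa using hfA p hp)
      (by simp [← hc]) ?_
    simp only [neg_apply, abs_neg]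
    exact neg_dominant_of_not_dominant hne hf

lemma lowerTri_eq : lowerTri = Icc 0 1 ∩ {p | p 1 ≤ midline (-1) (p 0)} := by
  ext p
  simp only [lowerTri, midline, mem_inter_iff, mem_ofPred_eq]
  refine and_congr_right fun _ => ?_
  constructor <;> intro h <;> linarith

lemma volume_lowerTri : volume lowerTri = 1 / 2 := by
  have hb : volume (box 2 ![1, 1]) = 1 := by
    simp [box, Real.volume_pi_Ico]
  have h11 : (![1, 1] : Fin 2 → ℝ) = 1 := by
    funext i
    fin_cases i <;> rfl
  have hsub : box 2 ![1, 1] ⊆ Icc 0 1 := box_subset_Icc h11.le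
  have hnull : volume (Icc (0 : Fin 2 → ℝ) 1 \ box 2 ![1, 1]) = 0 := by
    rw [measure_sdiff hsub (measurableSet_box _ _).nullMeasurableSet (by simp [hb]), hb,
      volume_Icc_fin_two, tsub_self]
  have hvol : volume.real ({p : Fin 2 → ℝ | p 1 ≤ midline (-1) (p 0)} ∩ box 2 ![1, 1]) = 1 / 2 := by
    have hm : (-1 : ℝ) ∈ Icc (-1 : ℝ) 1 := by norm_num
    rw [measureReal_subgraph_inter_box (continuous_midline _) zero_le_one zero_le_one
      fun u hu => (midline_mem_Icc hm hu).1,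
      intervalIntegral.integral_congr (g := fun u => 1 + (-1) * u + 0 * u ^ 2 + 0 * u ^ 3
        + 0 * u ^ 4 + 0 * u ^ 5), integral_quintic]
    · norm_num
    · intro u hu
      rw [uIcc_of_le zero_le_one] at hu
      simp only [min_eq_right (midline_mem_Icc hm hu).2]
      unfold midline
      ring
  have hlow : volume lowerTri = volume ({p : Fin 2 → ℝ | p 1 ≤ midline (-1) (p 0)} ∩
      box 2 ![1, 1]) := by
    rw [lowerTri_eq]
    refine le_antisymm ?_ (measure_mono fun p (hp : _ ∧ _) => ⟨hsub hp.2, hp.1⟩)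
    refine volume_le_of_subset_union_null ?_ hnull
    intro p hp
    by_cases hpb : p ∈ box 2 ![1, 1]
    · exact Or.inl ⟨hp.2, hpb⟩
    · exact Or.inr ⟨hp.1, hpb⟩
  have hfin : volume ({p : Fin 2 → ℝ | p 1 ≤ midline (-1) (p 0)} ∩ box 2 ![1, 1]) ≠ ∞ :=
    ne_of_lt ((measure_mono inter_subset_right).trans_lt (by simp [hb]))
  rw [hlow]
  conv_lhs => rw [← ENNReal.ofReal_toReal hfin, ← measureReal_def, hvol,
      ENNReal.ofReal_div_of_pos two_pos]
  simp

lemma measurableSet_lowerTri : MeasurableSet lowerTri :=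
  measurableSet_Icc.inter (measurableSet_le (f := fun p : Fin 2 → ℝ => p 0 + p 1)
    (by fun_prop) measurable_const)

lemma measurableSet_upperTri : MeasurableSet upperTri :=
  measurableSet_Icc.inter (measurableSet_le (g := fun p : Fin 2 → ℝ => p 0 + p 1)
    measurable_const (by fun_prop))

lemma volume_upperTri : volume upperTri = 1 / 2 := by
  rw [← volume_lowerTri, ← measurePreserving_one_sub.measure_preimage
    measurableSet_lowerTri.nullMeasurableSet]
  congr 1
  ext p
  simp only [upperTri, lowerTri, mem_preimage, mem_ofPred_eq]
  refine and_congr ?_ ?_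
  · exact (Set.ext_iff.1 one_sub_preimage_Icc p).symm
  · simp only [Pi.sub_apply, Pi.one_apply]
    constructor <;> intro h <;> linarith

lemma lowerTri_union_upperTri : lowerTri ∪ upperTri = Icc 0 1 := by
  ext p
  simp only [upperTri, lowerTri, mem_union, mem_ofPred_eq, ← and_or_left]
  exact and_iff_left (le_total _ _)

lemma volume_lowerTri_inter_upperTri : volume (lowerTri ∩ upperTri) = 0 := by
  have h := measure_union_add_inter (μ := volume) lowerTri measurableSet_upperTri
  rw [lowerTri_union_upperTri, volume_lowerTri, volume_upperTri, volume_Icc_fin_two,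
    ENNReal.add_halves] at h
  exact (ENNReal.add_right_inj ENNReal.one_ne_top).1 (h.trans (add_zero 1).symm)

lemma meanDisc2_triangles : meanDisc2 (fun i => if i = 0 then lowerTri else upperTri) = 1 / 20 := by
  rw [meanDisc2_eq]
  · simp only [if_true]
    rw [integral_sq_imbalance_congr (B := {p | p 1 ≤ midline (-1) (p 0)}),
      integral_sq_imbalance_midline (by norm_num),
      integral_sq_tent_nonpos_slope le_rfl (by norm_num)]
    · norm_num
    · intro x hx
      rw [lowerTri_eq, inter_assoc, inter_eq_right.2]
      exact inter_subset_right.trans (box_subset_Icc hx.2)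
  · exact measurableSet_lowerTri
  · intro i
    fin_cases i
    · exact volume_lowerTri
    · exact volume_upperTri
  · exact fun x hx => measureReal_inter_box_add measurableSet_upperTri lowerTri_union_upperTri
      volume_lowerTri_inter_upperTri hx

/-- The stratified sample based on the two triangles cut by the anti-diagonal has mean
squared `L2`-discrepancy `1/20`, and this is minimal among all equivolume partitions
of `[0,1]²` into two closed convex sets. -/
theorem stmt18 :
    meanDisc2 (fun i => if i = 0 then lowerTri else upperTri) = 1 / 20
    ∧ ∀ Ω : Fin 2 → Set (Fin 2 → ℝ),
        (∀ i, IsClosed (Ω i)) → (∀ i, Convex ℝ (Ω i)) →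
        (∀ i, volume (Ω i) = 1 / 2) →
        (⋃ i, Ω i) = Set.Icc (0 : Fin 2 → ℝ) 1 →
        volume (Ω 0 ∩ Ω 1) = 0 →
        meanDisc2 (fun i => if i = 0 then lowerTri else upperTri) ≤ meanDisc2 Ω := by
  refine ⟨meanDisc2_triangles, fun Ω hcl hconv hv hU hnull => ?_⟩
  have hU' : Ω 0 ∪ Ω 1 = Icc 0 1 := by
    rw [← hU]
    ext p
    simp [Fin.exists_fin_two]
  rw [meanDisc2_triangles, meanDisc2_eq (hcl 0).measurableSet hv fun x hx =>
    measureReal_inter_box_add (hcl 1).measurableSet hU' hnull hx]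
  have := integral_sq_imbalance_le_of_convex (hconv 0) (hconv 1) (hcl 1).measurableSet (hv 0) (hv 1)
    hU' hnull
  linarith
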